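/- Let w be a pangrammatic word on a finite alphabet S, let f : S → T and g : T → U be surjections, and let u ∈ U. Then r( r(f(w)) | g⁻¹(u) ) = r( f( r( w | (g∘f)⁻¹(u) ) ) ), all restrictions being defined. (This is the middle coassociativity identity in the proof that the word species with the decomposition maps Δ_f forms a cooperad.) -/

import Mathlib

/-- One-step reduction of words: either an adjacent equal pair `aa` is replaced
by `a`, or (for a word of length at least two whose first and last letters are
equal) the last letter is deleted. -/
def Step {S : Type*} (w v : List S) : Prop :=
  (∃ (u₁ : List S) (a : S) (u₂ : List S), w = u₁ ++ [a, a] ++ u₂ ∧ v = u₁ ++ [a] ++ u₂) ∨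
  (2 ≤ w.length ∧ w.head? = w.getLast? ∧ v = w.dropLast)

/-- A word is reduced if it has no two equal adjacent letters and either has
length one or has different first and last letters. -/
def Reduced {S : Type*} (w : List S) : Prop :=
  w.Chain' (· ≠ ·) ∧ (w.length = 1 ∨ w.head? ≠ w.getLast?)

/-- `IsReduction w u` : the reduced word `u` is obtainable from `w` by a finite
(possibly empty) sequence of one-step reductions, i.e. `u = r(w)`. -/
def IsReduction {S : Type*} (w u : List S) : Prop :=
  Relation.ReflTransGen Step w u ∧ Reduced u

open Classical in
/-- The restriction `w|A` of a word to a sub-alphabet `A`: delete all letters not in `A`. -/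
noncomputable def restrictWord {S : Type*} (w : List S) (A : Set S) : List S :=
  w.filter fun a => decide (a ∈ A)

/-- A word is crossing if it contains the pattern `… a … b … a … b …` with `a ≠ b`. -/
def Crossing {S : Type*} (w : List S) : Prop :=
  ∃ (i j k l : ℕ) (hij : i < j) (hjk : j < k) (hkl : k < l) (hl : l < w.length),
    w[i]'(by omega) = w[k]'(by omega) ∧ w[j]'(by omega) = w[l]'hl ∧
    w[i]'(by omega) ≠ w[j]'(by omega)

open Classical in
noncomputable def dd {S : Type*} : List S → List S
  | [] => []
  | a :: l => if l.head? = some a then dd l else a :: dd l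

open Classical in
noncomputable def trimW {S : Type*} (l : List S) : List S :=
  if 2 ≤ l.length ∧ l.head? = l.getLast? then l.dropLast else l

theorem dd_head {S : Type*} (l : List S) : (dd l).head? = l.head? := by
  induction l with
  | nil => rfl
  | cons a l ih =>
    simp only [dd]
    split_ifs with h
    · rw [ih, h]; rfl
    · rfl

theorem dd_snoc {S : Type*} (l : List S) (c : S) :
    (l.getLast? = some c → dd (l ++ [c]) = dd l) ∧
    (l.getLast? ≠ some c → dd (l ++ [c]) = dd l ++ [c]) := by
  induction l with
  | nil => simp [dd]
  | cons a l ih =>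
    cases l with
    | nil =>
      by_cases h : c = a
      · simp [dd, h]
      · simp [dd, h, Ne.symm h]
    | cons b l =>
      have e : (a :: b :: l).getLast? = (b :: l).getLast? := by simp [List.getLast?_cons_cons]
      rw [e]
      classical
      have e2 : ∀ m : List S, dd (a :: b :: m) = if b = a then dd (b :: m) else a :: dd (b :: m) := by
        intro m
        rw [dd]; by_cases hb : b = a <;> simp [hb]
      constructor
      · intro h
        have := ih.1 h
        simp only [List.cons_append] at this ⊢
        rw [e2, e2, this]
      · intro h
        have := ih.2 h
        simp only [List.cons_append] at this ⊢
        rw [e2, e2, this]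
        split_ifs <;> rfl

theorem dd_last {S : Type*} (l : List S) : (dd l).getLast? = l.getLast? := by
  induction l using List.reverseRecOn with
  | nil => rfl
  | append_singleton l c ih =>
    by_cases h : l.getLast? = some c
    · rw [(dd_snoc l c).1 h, ih, h]; simp
    · rw [(dd_snoc l c).2 h]; simp

theorem dd_pair {S : Type*} (u : List S) (a : S) (v : List S) :
    dd (u ++ [a, a] ++ v) = dd (u ++ [a] ++ v) := by
  induction u with
  | nil => simp [dd]
  | cons b u ih =>
    have : (u ++ [a, a] ++ v).head? = (u ++ [a] ++ v).head? := by cases u <;> simp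
    simp only [List.cons_append, dd]
    rw [this, ih]

theorem dd_chain {S : Type*} (l : List S) (h : l.IsChain (· ≠ ·)) : dd l = l := by
  induction l with
  | nil => rfl
  | cons a l ih =>
    cases l with
    | nil => simp [dd]
    | cons b l =>
      rw [List.isChain_cons_cons] at h
      rw [dd, ih h.2, if_neg]
      simpa using Ne.symm h.1

theorem norm_step {S : Type*} {w v : List S} (h : Step w v) : trimW (dd w) = trimW (dd v) := by
  rcases h with ⟨u₁, a, u₂, rfl, rfl⟩ | ⟨h2, he, rfl⟩
  · rw [dd_pair]
  · rcases List.eq_nil_or_concat w with rfl | ⟨m, c, rfl⟩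
    · simp at h2
    · simp only [List.concat_eq_append] at *
      rw [List.dropLast_concat]
      have hm : m ≠ [] := by rintro rfl; simp at h2
      have hh : m.head? = some c := by
        cases m with
        | nil => exact absurd rfl hm
        | cons b m => rw [List.getLast?_concat] at he; simpa using he
      by_cases h : m.getLast? = some c
      · rw [(dd_snoc m c).1 h]
      · rw [(dd_snoc m c).2 h]
        have h1 : (dd m).head? = some c := by rw [dd_head, hh]
        have h3 : (dd m).getLast? ≠ some c := by rwa [dd_last]
        have h4 : dd m ≠ [] := by intro h; simp [h] at h1
        have h5 : 0 < (dd m).length := List.length_pos_of_ne_nil h4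
        unfold trimW
        rw [if_pos, if_neg, List.dropLast_concat]
        · rintro ⟨-, h⟩; exact h3 (by rw [← h, h1])
        · refine ⟨by simp; omega, ?_⟩
          simp [List.head?_append, h1]

theorem norm_steps {S : Type*} {w v : List S} (h : Relation.ReflTransGen Step w v) :
    trimW (dd w) = trimW (dd v) := by
  induction h with
  | refl => rfl
  | tail _ h ih => rw [ih, norm_step h]

theorem norm_reduced {S : Type*} {w : List S} (h : Reduced w) : trimW (dd w) = w := by
  rw [dd_chain w h.1, trimW, if_neg]
  rintro ⟨h2, he⟩
  rcases h.2 with h | h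
  · omega
  · exact h he

theorem step_map {S T : Type*} (f : S → T) {w v : List S} (h : Step w v) :
    Step (w.map f) (v.map f) := by
  rcases h with ⟨u₁, a, u₂, rfl, rfl⟩ | ⟨h2, he, rfl⟩
  · exact Or.inl ⟨u₁.map f, f a, u₂.map f, by simp, by simp⟩
  · exact Or.inr ⟨by simpa using h2, by simp [he], by simp [List.map_dropLast]⟩

theorem step_restrict {S : Type*} (A : Set S) {w v : List S} (h : Step w v) :
    Relation.ReflTransGen Step (restrictWord w A) (restrictWord v A) := by
  rcases h with ⟨u₁, a, u₂, rfl, rfl⟩ | ⟨h2, he, rfl⟩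
  · by_cases ha : a ∈ A
    · exact .single (Or.inl ⟨restrictWord u₁ A, a, restrictWord u₂ A,
        by simp [restrictWord, ha], by simp [restrictWord, ha]⟩)
    · have : restrictWord (u₁ ++ [a, a] ++ u₂) A = restrictWord (u₁ ++ [a] ++ u₂) A := by
        simp [restrictWord, ha]
      rw [this]
  · rcases List.eq_nil_or_concat w with rfl | ⟨m, c, rfl⟩
    · simp at h2
    · simp only [List.concat_eq_append] at *
      rw [List.dropLast_concat]
      cases m with
      | nil => simp at h2
      | cons b m =>
        have hb : b = c := by
          rw [List.getLast?_concat] at he; simpa using he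
        subst hb
        by_cases ha : b ∈ A
        · refine .single (Or.inr ⟨?_, ?_, ?_⟩)
          · simp [restrictWord, ha]
          · simp [restrictWord, ha, List.getLast?_cons]
          · have : restrictWord (b :: m ++ [b]) A = restrictWord (b :: m) A ++ [b] := by
              simp [restrictWord, ha]
            rw [this, List.dropLast_concat]
        · have : restrictWord (b :: m ++ [b]) A = restrictWord (b :: m) A := by
            simp [restrictWord, ha]
          rw [this]

theorem steps_restrict {S : Type*} (A : Set S) {w v : List S}
    (h : Relation.ReflTransGen Step w v) :
    Relation.ReflTransGen Step (restrictWord w A) (restrictWord v A) := by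
  induction h with
  | refl => exact .refl
  | tail _ h ih => exact ih.trans (step_restrict A h)

theorem steps_map {S T : Type*} (f : S → T) {w v : List S}
    (h : Relation.ReflTransGen Step w v) :
    Relation.ReflTransGen Step (w.map f) (v.map f) := by
  induction h with
  | refl => exact .refl
  | tail _ h ih => exact ih.tail (step_map f h)

/-- The middle coassociativity identity for the word cooperad: for a
pangrammatic word `w` on `S`, surjections `f : S → T`, `g : T → U`, and
`u₀ ∈ U`, one has `r(r(f(w)) | g⁻¹(u₀)) = r(f(r(w | (g∘f)⁻¹(u₀))))`. -/
theorem coassociativity_middle {S T U : Type*} [Fintype S] [Fintype T] [Fintype U]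
    (f : S → T) (g : T → U) (hf : Function.Surjective f) (hg : Function.Surjective g)
    (w : List S) (hw : w ≠ []) (hpan : ∀ s : S, s ∈ w) (u₀ : U)
    (x : List T) (hx : IsReduction (w.map f) x)
    (p : List T) (hp : IsReduction (restrictWord x (g ⁻¹' {u₀})) p)
    (y : List S) (hy : IsReduction (restrictWord w ((g ∘ f) ⁻¹' {u₀})) y)
    (q : List T) (hq : IsReduction (y.map f) q) :
    p = q := by
  have e : restrictWord (w.map f) (g ⁻¹' {u₀}) = (restrictWord w ((g ∘ f) ⁻¹' {u₀})).map f := by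
    simp only [restrictWord, List.filter_map]
    rfl
  have h1 : Relation.ReflTransGen Step (restrictWord (w.map f) (g ⁻¹' {u₀}))
      (restrictWord x (g ⁻¹' {u₀})) := by
    exact steps_restrict _ hx.1
  have h2 : Relation.ReflTransGen Step ((restrictWord w ((g ∘ f) ⁻¹' {u₀})).map f) (y.map f) :=
    steps_map f hy.1
  rw [← norm_reduced hp.2, ← norm_reduced hq.2, ← norm_steps (h1.trans hp.1),
    ← norm_steps (h2.trans hq.1), e]
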